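/- Let d ≥ 1 and let φ : ℝ → (ℝ^d → ℝ^d) be a one-parameter group of maps (φ_0 = id, φ_{s+t} = φ_s ∘ φ_t) with (t,x) ↦ φ_t(x) of class C^∞. Let K ⊆ ℝ^d be compact, K' a compact set containing K and the relevant images, and let S_τ : ℝ^d → ℝ^d, |τ| < τ0, be a family of bijections, C^∞ in (τ,x) with all derivatives bounded on (−τ0,τ0) × K', such that for some integer n ≥ 1, some C^1 function C : K' → ℝ^d with bounded derivative, and some constant C1 > 0, ‖S_τ(x) − φ_τ(x) − τ^{2n+1} C(x)‖ ≤ C1 |τ|^{2n+2} for all x ∈ K' and |τ| < τ0. Then there exist C2 > 0 and 0 < τ1 ≤ τ0 such that for all |τ| < τ1 and x ∈ K, ‖(S_{−τ})^{−1}(x) − S_τ(x)‖ ≤ C2 |τ|^{2n+2}; that is, a method of order 2n is automatically pseudo-symmetric of pseudo-symmetry order q ≥ 2n+1. -/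

import Mathlib

section

open Set Filter Topology

variable {E F : Type*} [NormedAddCommGroup E] [NormedSpace ℝ E] [NormedAddCommGroup F]

/-- A `C¹` function on a compact set is pointwise Lipschitz with a uniform constant. -/
theorem ContDiffOn.exists_eventually_norm_sub_le [NormedSpace ℝ F] {f : E → F} {s : Set E}
    (hs : IsCompact s) (hf : ContDiffOn ℝ 1 f s) :
    ∃ B : ℝ, 0 ≤ B ∧ ∀ y ∈ s, ∀ᶠ x in 𝓝[s] y, ‖f x - f y‖ ≤ B * ‖x - y‖ := by
  refine hs.induction_on
    (p := fun t => ∃ B : ℝ, 0 ≤ B ∧ ∀ y ∈ t, ∀ᶠ x in 𝓝[s] y, ‖f x - f y‖ ≤ B * ‖x - y‖)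
    ⟨0, le_rfl, by simp⟩ (fun _ _ hst ⟨B, hB0, hB⟩ => ⟨B, hB0, fun y hy => hB y (hst hy)⟩) ?_ ?_
  · rintro t₁ t₂ ⟨B₁, hB₁, h₁⟩ ⟨B₂, hB₂, h₂⟩
    refine ⟨max B₁ B₂, le_max_of_le_left hB₁, ?_⟩
    rintro y (hy | hy)
    · filter_upwards [h₁ y hy] with x hx
      exact hx.trans (by gcongr; exact le_max_left _ _)
    · filter_upwards [h₂ y hy] with x hx
      exact hx.trans (by gcongr; exact le_max_right _ _)
  · intro z hz
    obtain ⟨u, hu, -, -, f', hf', hc⟩ :=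
      (contDiffWithinAt_succ_iff_hasFDerivWithinAt' (n := 0) (by simp)).1
        (by simpa using hf z hz)
    rw [insert_eq_of_mem hz] at hu
    have hb : ∀ᶠ y in 𝓝[s] z, ‖f' y‖ < ‖f' z‖ + 1 :=
      hc.continuousWithinAt.norm.eventually_lt_const (by linarith)
    refine ⟨_, inter_mem hu hb, ‖f' z‖ + 1 + 1, by positivity, ?_⟩
    rintro y ⟨hyu, hyb⟩
    filter_upwards [(hf' y hyu).isLittleO.def one_pos] with x hx
    have h₁ : ‖f' y (x - y)‖ ≤ (‖f' z‖ + 1) * ‖x - y‖ :=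
      (f' y).le_of_opNorm_le (le_of_lt hyb) _
    have h₂ := norm_add_le (f x - f y - f' y (x - y)) (f' y (x - y))
    rw [sub_add_cancel] at h₂
    linarith

/-- A curve of points solving `f (t, y) = const` has uniformly bounded speed near `t = 0`, when `f`
is `C¹` on `I ×ˢ K` with `K` compact and `f (0, ·)` is the identity on `K`. -/
theorem exists_eventually_norm_snd_sub_le_of_eq {f : ℝ × E → E} {I : Set ℝ} {K : Set E}
    (hI : I ∈ 𝓝 0) (hK : IsCompact K) (hf : ContDiffOn ℝ 1 f (I ×ˢ K))
    (hf0 : ∀ x ∈ K, f (0, x) = x) :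
    ∃ M : ℝ, 0 ≤ M ∧ ∀ᶠ τ in 𝓝 (0 : ℝ), ∀ y ∈ K, ∀ᶠ p in 𝓝[I ×ˢ K] (τ, y),
      f p = f (τ, y) → ‖p.2 - y‖ ≤ M * |p.1 - τ| := by
  refine hK.induction_on
    (p := fun t => ∃ M : ℝ, 0 ≤ M ∧ ∀ᶠ τ in 𝓝 (0 : ℝ), ∀ y ∈ t, ∀ᶠ p in 𝓝[I ×ˢ K] (τ, y),
      f p = f (τ, y) → ‖p.2 - y‖ ≤ M * |p.1 - τ|)
    ⟨0, le_rfl, by simp⟩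
    (fun _ _ hst ⟨M, hM0, hM⟩ => ⟨M, hM0, hM.mono fun τ h y hy => h y (hst hy)⟩) ?_ ?_
  · rintro t₁ t₂ ⟨M₁, hM₁, h₁⟩ ⟨M₂, hM₂, h₂⟩
    refine ⟨max M₁ M₂, le_max_of_le_left hM₁, ?_⟩
    filter_upwards [h₁, h₂] with τ h₁ h₂
    rintro y (hy | hy)
    · filter_upwards [h₁ y hy] with p hp he
      exact (hp he).trans (by gcongr; exact le_max_left _ _)
    · filter_upwards [h₂ y hy] with p hp he
      exact (hp he).trans (by gcongr; exact le_max_right _ _)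
  · intro z hz
    have h0I : (0 : ℝ) ∈ I := mem_of_mem_nhds hI
    have hmem : ((0 : ℝ), z) ∈ I ×ˢ K := ⟨h0I, hz⟩
    obtain ⟨u, hu, -, -, f', hf', hc⟩ :=
      (contDiffWithinAt_succ_iff_hasFDerivWithinAt' (n := 0) (by simp)).1
        (by simpa using hf _ hmem)
    rw [insert_eq_of_mem hmem] at hu
    have hb : ∀ᶠ p in 𝓝[I ×ˢ K] ((0 : ℝ), z), ‖f' p - f' (0, z)‖ < 1 / 4 := by
      have := hc.continuousWithinAt.sub (continuousWithinAt_const (b := f' (0, z))) |>.norm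
      exact this.eventually_lt_const (by norm_num)
    have hub := inter_mem hu hb
    rw [nhdsWithin_prod_eq, nhdsWithin_eq_nhds.2 hI, mem_prod_iff] at hub
    obtain ⟨A, hA, t, ht, hAt⟩ := hub
    refine ⟨t ∩ K, inter_mem ht self_mem_nhdsWithin, 4 * (‖f' (0, z)‖ + 1), by positivity, ?_⟩
    filter_upwards [hA] with τ hτ
    rintro y ⟨hyt, hyK⟩
    obtain ⟨hu₁, hb₁⟩ := hAt (mk_mem_prod hτ hyt)
    obtain ⟨hu₀, hb₀⟩ := hAt (mk_mem_prod (mem_of_mem_nhds hA) hyt)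
    rw [mem_ofPred_eq] at hb₁ hb₀
    have e₁ := (hf' _ hu₁).isLittleO.def (c := 1 / 8) (by norm_num)
    have e₀ := (hf' _ hu₀).isLittleO.def (c := 1 / 8) (by norm_num)
    have htend : Tendsto (fun p : ℝ × E => ((0 : ℝ), p.2)) (𝓝[I ×ˢ K] (τ, y))
        (𝓝[I ×ˢ K] ((0 : ℝ), y)) := by
      refine tendsto_nhdsWithin_iff.2 ⟨?_, ?_⟩
      · exact ((by fun_prop : Continuous fun p : ℝ × E => ((0 : ℝ), p.2)).tendsto
          (τ, y)).mono_left nhdsWithin_le_nhds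
      · filter_upwards [self_mem_nhdsWithin] with p hp using ⟨h0I, hp.2⟩
    filter_upwards [e₁, htend.eventually e₀, self_mem_nhdsWithin] with p h₁ h₀ hp he
    set h := p.1 - τ
    set k := p.2 - y with hk
    have hpk : p - (τ, y) = (h, k) := rfl
    have hpk0 : ((0 : ℝ), p.2) - (0, y) = (0, k) := by simp [hk]
    rw [he, sub_self, zero_sub, norm_neg, hpk] at h₁
    rw [hf0 _ hp.2, hf0 _ hyK, hpk0, ← hk] at h₀
    have n₁ : ‖(h, k)‖ ≤ |h| + ‖k‖ := by
      rw [Prod.norm_mk]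
      exact max_le_add_of_nonneg (norm_nonneg _) (norm_nonneg _)
    have n₀ : ‖((0 : ℝ), k)‖ = ‖k‖ := by simp
    have n₂ : ‖(h, (0 : E))‖ = |h| := by simp
    have hsplit : k = (k - f' (0, y) (0, k)) + f' (τ, y) (h, k)
        - (f' (τ, y) - f' (0, z)) (0, k) + (f' (0, y) - f' (0, z)) (0, k)
        - (f' (τ, y) - f' (0, z)) (h, 0) - f' (0, z) (h, 0) := by
      have : (h, k) = (h, (0 : E)) + (0, k) := by simp
      rw [this, map_add]
      simp only [sub_apply]
      abel
    have b₁ := (f' (τ, y) - f' (0, z)).le_of_opNorm_le hb₁.le (0, k)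
    have b₂ := (f' (0, y) - f' (0, z)).le_of_opNorm_le hb₀.le (0, k)
    have b₃ := (f' (τ, y) - f' (0, z)).le_of_opNorm_le hb₁.le (h, 0)
    have b₄ := (f' (0, z)).le_opNorm (h, 0)
    rw [n₀] at b₁ b₂ h₀
    rw [n₂] at b₃ b₄
    have hle : ‖k‖ ≤ ‖k - f' (0, y) (0, k)‖ + ‖f' (τ, y) (h, k)‖
        + ‖(f' (τ, y) - f' (0, z)) (0, k)‖ + ‖(f' (0, y) - f' (0, z)) (0, k)‖
        + ‖(f' (τ, y) - f' (0, z)) (h, 0)‖ + ‖f' (0, z) (h, 0)‖ := by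
      conv_lhs => rw [hsplit]
      refine (norm_sub_le _ _).trans (add_le_add_left ((norm_sub_le _ _).trans
        (add_le_add_left ((norm_add_le _ _).trans (add_le_add_left ((norm_sub_le _ _).trans
        (add_le_add_left (norm_add_le _ _) _)) _)) _)) _)
    have hh0 := abs_nonneg h
    have hk0 := norm_nonneg k
    nlinarith

/-- A function on an interval that is pointwise Lipschitz with constant `M` everywhere is
Lipschitz with any larger constant. -/
theorem norm_sub_le_of_eventually_norm_sub_le {g : ℝ → F} {a b M : ℝ} (hab : a ≤ b)
    (hg : ∀ s ∈ Icc a b, ∀ᶠ t in 𝓝 s, ‖g t - g s‖ ≤ M * |t - s|) :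
    ‖g b - g a‖ ≤ (M + 1) * (b - a) := by
  have hcont : ContinuousOn g (Icc a b) := by
    intro s hs
    refine ContinuousAt.continuousWithinAt ?_
    refine tendsto_iff_norm_sub_tendsto_zero.2 ?_
    refine squeeze_zero' (Eventually.of_forall fun _ => norm_nonneg _) (hg s hs) ?_
    have : Continuous fun t : ℝ => M * |t - s| := by fun_prop
    simpa using this.tendsto s
  have key := image_norm_le_of_liminf_right_slope_norm_lt_deriv_boundary
    (f := fun t => g t - g a) (f' := fun _ => M) (a := a) (b := b)
    (B := fun t => (M + 1) * (t - a)) (B' := fun _ => M + 1)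
    (hcont.sub continuousOn_const) ?_ (by simp) (by fun_prop) ?_ (fun _ _ _ => by linarith)
  · exact key (right_mem_Icc.2 hab)
  · intro s hs r hr
    refine Eventually.frequently ?_
    filter_upwards [(hg s (Ico_subset_Icc_self hs)).filter_mono nhdsWithin_le_nhds,
      self_mem_nhdsWithin] with t ht hst
    have hst' : 0 < t - s := sub_pos.2 hst
    rw [slope_def_field, div_lt_iff₀ hst']
    have h₁ := norm_sub_norm_le (g t - g a) (g s - g a)
    rw [sub_sub_sub_cancel_right] at h₁
    rw [abs_of_pos hst'] at ht
    simp only [Function.comp_apply]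
    nlinarith
  · intro s _
    simpa using (((hasDerivAt_id s).sub_const a).const_mul (M + 1)).hasDerivWithinAt

/-- The displacement of a smooth flow has Lipschitz constant `O(τ)` on bounded sets. -/
theorem exists_norm_flow_sub_sub_le [NormedSpace ℝ F] [ProperSpace E] {φ : ℝ → E → F}
    (hφ : ContDiff ℝ 2 fun p : ℝ × E => φ p.1 p.2) (R : ℝ) :
    ∃ L : ℝ, 0 ≤ L ∧ ∀ τ : ℝ, |τ| ≤ 1 → ∀ x y : E, ‖x‖ ≤ R → ‖y‖ ≤ R →
      ‖φ τ x - φ τ y - (φ 0 x - φ 0 y)‖ ≤ L * ‖x - y‖ * |τ| := by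
  set f : ℝ × E → F := fun p => φ p.1 p.2 with hf
  have hG : ContDiff ℝ 1 fun p => fderiv ℝ f p ((1 : ℝ), (0 : E)) :=
    (hφ.fderiv_right (m := 1) (by norm_num)).clm_apply contDiff_const
  obtain ⟨L, hL⟩ := hG.contDiffOn.exists_lipschitzOnWith
    (s := Icc (-1 : ℝ) 1 ×ˢ Metric.closedBall (0 : E) R) one_ne_zero
    ((convex_Icc _ _).prod (convex_closedBall _ _))
    (isCompact_Icc.prod (isCompact_closedBall _ _))
  have hd : ∀ (x : E) (t : ℝ), HasDerivAt (fun s => φ s x) (fderiv ℝ f (t, x) (1, 0)) t := by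
    intro x t
    exact ((hφ.differentiable (by norm_num) (t, x)).hasFDerivAt).comp_hasDerivAt t
      ((hasDerivAt_id t).prodMk (hasDerivAt_const t x))
  refine ⟨L, L.2, fun τ hτ x y hx hy => ?_⟩
  have := (convex_Icc (-1 : ℝ) 1).norm_image_sub_le_of_norm_hasDerivWithin_le
    (f := fun t => φ t x - φ t y) (C := L * ‖x - y‖)
    (fun t _ => ((hd x t).sub (hd y t)).hasDerivWithinAt) (fun t ht => ?_)
    (show (0 : ℝ) ∈ Icc (-1 : ℝ) 1 by simp) (abs_le.1 hτ)
  · simpa using this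
  · have := hL.norm_sub_le (x := (t, x)) (y := (t, y))
      ⟨ht, by simpa using hx⟩ ⟨ht, by simpa using hy⟩
    simpa using this

/-- A selection of preimages `f (t, y t) = c` in a compact set is continuous when it is unique. -/
theorem tendsto_of_isCompact_of_injOn {X Y : Type*} [TopologicalSpace X] [TopologicalSpace Y]
    [T2Space Y] {f : ℝ × X → Y} {I : Set ℝ} {K : Set X} {y : ℝ → X} {c : Y} {s : ℝ}
    (hI : I ∈ 𝓝 s) (hK : IsCompact K) (hf : ContinuousOn f (I ×ˢ K))
    (hyK : ∀ t ∈ I, y t ∈ K) (hy : ∀ t ∈ I, f (t, y t) = c)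
    (hinj : InjOn (fun x => f (s, x)) K) : Tendsto y (𝓝 s) (𝓝 (y s)) := by
  have hs : s ∈ I := mem_of_mem_nhds hI
  refine hK.tendsto_nhds_of_unique_mapClusterPt (eventually_of_mem hI hyK) fun z hz hcl => ?_
  obtain ⟨U, hU, hUz⟩ := mapClusterPt_iff_ultrafilter.1 hcl
  have hUI : ∀ᶠ t in (U : Filter ℝ), t ∈ I := hU hI
  have h₁ : Tendsto (fun t => (t, y t)) U (𝓝[I ×ˢ K] (s, z)) :=
    tendsto_nhdsWithin_iff.2 ⟨Tendsto.prodMk_nhds hU hUz, hUI.mono fun t ht => ⟨ht, hyK t ht⟩⟩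
  have h₂ : Tendsto (fun t => f (t, y t)) U (𝓝 (f (s, z))) := (hf (s, z) ⟨hs, hz⟩).tendsto.comp h₁
  have h₃ : f (s, z) = c :=
    tendsto_nhds_unique h₂ (tendsto_const_nhds.congr' (hUI.mono fun t ht => (hy t ht).symm))
  exact hinj hz (hyK s hs) (h₃.trans (hy s hs).symm)

end


/-- **Remark after Proposition 2.**
A smooth method `S_τ` of (even) order `2n` for the flow `φ`, with
`S_τ = φ_τ + τ^{2n+1} C + O(τ^{2n+2})` uniformly on compacts, is automatically
pseudo-symmetric of pseudo-symmetry order at least `2n+1`: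
`(S_{-τ})⁻¹ = S_τ + O(τ^{2n+2})` uniformly on the compact set `K`. -/
theorem order_2n_implies_pseudo_symmetry_2n1
    (d : ℕ) (hd : 1 ≤ d) (τ0 : ℝ) (hτ0 : 0 < τ0)
    (φ : ℝ → (Fin d → ℝ) → (Fin d → ℝ))
    (hφ0 : φ 0 = id)
    (hφgrp : ∀ s t : ℝ, φ (s + t) = φ s ∘ φ t)
    (hφsmooth : ContDiff ℝ (⊤ : ℕ∞) (fun p : ℝ × (Fin d → ℝ) => φ p.1 p.2))
    (K K' : Set (Fin d → ℝ)) (hK : IsCompact K) (hK' : IsCompact K') (hKK' : K ⊆ K')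
    (S : ℝ → (Fin d → ℝ) → (Fin d → ℝ))
    (hbij : ∀ τ : ℝ, |τ| < τ0 → Function.Bijective (S τ))
    (himg : ∀ τ : ℝ, |τ| < τ0 →
      S τ '' K ⊆ K' ∧ Function.invFun (S τ) '' K ⊆ K' ∧ φ τ '' K ⊆ K')
    (hsmooth : ContDiffOn ℝ (⊤ : ℕ∞) (fun p : ℝ × (Fin d → ℝ) => S p.1 p.2)
      (Set.Ioo (-τ0) τ0 ×ˢ K'))
    (hbound : ∀ n : ℕ, ∃ B : ℝ, ∀ p ∈ Set.Ioo (-τ0) τ0 ×ˢ K',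
      ‖iteratedFDerivWithin ℝ n (fun p : ℝ × (Fin d → ℝ) => S p.1 p.2)
        (Set.Ioo (-τ0) τ0 ×ˢ K') p‖ ≤ B)
    (n : ℕ) (hn : 1 ≤ n)
    (C : (Fin d → ℝ) → (Fin d → ℝ))
    (hC : ContDiffOn ℝ 1 C K')
    (hCbdd : ∃ B : ℝ, ∀ x ∈ K',
      ‖C x‖ ≤ B ∧ ‖iteratedFDerivWithin ℝ 1 C K' x‖ ≤ B)
    (C1 : ℝ) (hC1 : 0 < C1)
    (horder : ∀ τ : ℝ, |τ| < τ0 → ∀ x ∈ K',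
      ‖S τ x - φ τ x - τ ^ (2 * n + 1) • C x‖ ≤ C1 * |τ| ^ (2 * n + 2)) :
    ∃ C2 > 0, ∃ τ1 : ℝ, 0 < τ1 ∧ τ1 ≤ τ0 ∧
      ∀ τ : ℝ, |τ| < τ1 → ∀ x ∈ K,
        ‖Function.invFun (S (-τ)) x - S τ x‖ ≤ C2 * |τ| ^ (2 * n + 2) := by
  have hS0 : ∀ x ∈ K', S 0 x = x := by
    intro x hx
    have h := horder 0 (by simpa using hτ0) x hx
    simpa [hφ0, sub_eq_zero] using h
  have hmem : ∀ s : ℝ, |s| < τ0 ↔ s ∈ Set.Ioo (-τ0) τ0 := fun s => abs_lt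
  have hI : Set.Ioo (-τ0) τ0 ∈ nhds (0 : ℝ) := Ioo_mem_nhds (by linarith) hτ0
  obtain ⟨B, hB0, hB⟩ := hC.exists_eventually_norm_sub_le hK'
  obtain ⟨M, hM0, hM⟩ := exists_eventually_norm_snd_sub_le_of_eq hI hK'
    (hsmooth.of_le (by exact_mod_cast le_top)) hS0
  obtain ⟨ε, hε, hMε⟩ := Metric.eventually_nhds_iff.1 hM
  obtain ⟨Bc, hBc⟩ := hCbdd
  obtain ⟨R, hR⟩ := (((isCompact_Icc (a := (-1 : ℝ)) (b := 1)).prod hK').image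
    hφsmooth.continuous).isBounded.exists_norm_le
  obtain ⟨R', hR'⟩ := hK.isBounded.exists_norm_le
  obtain ⟨L, hL0, hL⟩ := exists_norm_flow_sub_sub_le (φ := φ)
    (hφsmooth.of_le (WithTop.coe_le_coe.2 (le_top : (2 : ℕ∞) ≤ ⊤))) (max R R')
  have hright : ∀ s : ℝ, |s| < τ0 → ∀ x, S s (Function.invFun (S s) x) = x :=
    fun s hs x => Function.rightInverse_invFun (hbij s hs).surjective x
  have hpath : ∀ x ∈ K, ∀ s : ℝ, |s| < min ε τ0 →
      ∀ᶠ t in nhds s, ‖C (Function.invFun (S t) x) - C (Function.invFun (S s) x)‖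
        ≤ B * M * |t - s| := by
    intro x hx s hs
    have hsτ : |s| < τ0 := hs.trans_le (min_le_right _ _)
    have hsε : |s| < ε := hs.trans_le (min_le_left _ _)
    have hIs : Set.Ioo (-τ0) τ0 ∈ nhds s := isOpen_Ioo.mem_nhds ((hmem s).1 hsτ)
    have hyK : ∀ t ∈ Set.Ioo (-τ0) τ0, Function.invFun (S t) x ∈ K' := fun t ht =>
      (himg t ((hmem t).2 ht)).2.1 ⟨x, hx, rfl⟩
    have htend := tendsto_of_isCompact_of_injOn (y := fun t => Function.invFun (S t) x) (c := x)
      hIs hK' hsmooth.continuousOn hyK (fun t ht => hright t ((hmem t).2 ht) x)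
      (hbij s hsτ).injective.injOn
    have hyKs := hyK s ((hmem s).1 hsτ)
    have hev : ∀ᶠ t in nhds s, t ∈ Set.Ioo (-τ0) τ0 := hIs
    have h₁ := (tendsto_nhdsWithin_iff.2 ⟨htend, hev.mono hyK⟩).eventually (hB _ hyKs)
    have h₂ := (tendsto_nhdsWithin_iff.2 ⟨Filter.Tendsto.prodMk_nhds Filter.tendsto_id htend,
      hev.mono fun t ht => (⟨ht, hyK t ht⟩ : (t, Function.invFun (S t) x) ∈
        Set.Ioo (-τ0) τ0 ×ˢ K')⟩).eventually (hMε (by simpa using hsε) _ hyKs)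
    filter_upwards [h₁, h₂, hev] with t h₁ h₂ ht
    rw [mul_assoc]
    refine h₁.trans (mul_le_mul_of_nonneg_left (h₂ ?_) hB0)
    exact (hright t ((hmem t).2 ht) x).trans (hright s hsτ x).symm
  have hCpath : ∀ x ∈ K, ∀ s : ℝ, |s| < min ε τ0 →
      ‖C (Function.invFun (S s) x) - C x‖ ≤ (B * M + 1) * |s| := by
    intro x hx s hs
    have h0 : Function.invFun (S 0) x = x := by
      have h0τ : |(0 : ℝ)| < τ0 := by simpa using hτ0
      exact (hbij 0 h0τ).injective ((hright 0 h0τ x).trans (hS0 x (hKK' hx)).symm)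
    rcases le_total 0 s with h | h
    · have := norm_sub_le_of_eventually_norm_sub_le (g := fun t => C (Function.invFun (S t) x))
        (M := B * M) h fun t ht => hpath x hx t
          (by rw [abs_of_nonneg ht.1]; rw [abs_of_nonneg h] at hs; exact ht.2.trans_lt hs)
      simpa [h0, abs_of_nonneg h] using this
    · have := norm_sub_le_of_eventually_norm_sub_le (g := fun t => C (Function.invFun (S t) x))
        (M := B * M) h fun t ht => hpath x hx t
          (by rw [abs_of_nonpos ht.2]; rw [abs_of_nonpos h] at hs; linarith [ht.1])
      rw [norm_sub_rev, abs_of_nonpos h]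
      simpa [h0] using this
  refine ⟨L * (C1 + |Bc|) + C1 + C1 + (B * M + 1), by positivity, min (min ε τ0) 1,
    by positivity, (min_le_left _ _).trans (min_le_right _ _), fun τ hτ x hx => ?_⟩
  have hτ1 : |τ| < 1 := hτ.trans_le (min_le_right _ _)
  have hτετ : |τ| < min ε τ0 := hτ.trans_le (min_le_left _ _)
  have hττ0 : |τ| < τ0 := hτετ.trans_le (min_le_right _ _)
  have hnτ : |-τ| < τ0 := by rwa [abs_neg]
  have hCy := hCpath x hx (-τ) (by rwa [abs_neg])
  have hyK : Function.invFun (S (-τ)) x ∈ K' := (himg _ hnτ).2.1 ⟨x, hx, rfl⟩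
  have hSy := horder _ hnτ _ hyK
  rw [hright _ hnτ x] at hSy
  have hSx := horder _ hττ0 _ (hKK' hx)
  set y := Function.invFun (S (-τ)) x
  set b := φ (-τ) y
  have hφb : φ τ b = y := by
    have := congrFun (hφgrp τ (-τ)) y
    rw [add_neg_cancel, hφ0] at this
    exact this.symm
  have hodd : (-τ) ^ (2 * n + 1) = -τ ^ (2 * n + 1) := Odd.neg_pow ⟨n, rfl⟩ τ
  rw [hodd, abs_neg] at hSy
  rw [abs_neg] at hCy
  have hbR : ‖b‖ ≤ max R R' := (hR b ⟨(-τ, y), ⟨abs_le.1 (by rw [abs_neg]; exact hτ1.le), hyK⟩,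
    rfl⟩).trans (le_max_left _ _)
  have hflow := hL τ hτ1.le x b ((hR' x hx).trans (le_max_right _ _)) hbR
  rw [hφb, hφ0, id, id] at hflow
  have hτn := abs_nonneg τ
  have hpow : |τ| ^ (2 * n + 2) = |τ| ^ (2 * n + 1) * |τ| := pow_succ _ _
  have hpow0 : 0 ≤ |τ| ^ (2 * n + 1) := by positivity
  have hnorm : ‖τ ^ (2 * n + 1)‖ = |τ| ^ (2 * n + 1) := by rw [norm_pow, Real.norm_eq_abs]
  have hxb : ‖x - b‖ ≤ (C1 + |Bc|) * |τ| ^ (2 * n + 1) := by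
    have hCyb : ‖τ ^ (2 * n + 1) • C y‖ ≤ |τ| ^ (2 * n + 1) * |Bc| := by
      rw [norm_smul, hnorm]
      gcongr
      exact (hBc y hyK).1.trans (le_abs_self _)
    have h₁ : x - b = (x - b - (-τ ^ (2 * n + 1)) • C y) - τ ^ (2 * n + 1) • C y := by
      rw [neg_smul]; abel
    have h₂ : C1 * |τ| ^ (2 * n + 2) ≤ C1 * |τ| ^ (2 * n + 1) := by
      rw [hpow]
      exact mul_le_mul_of_nonneg_left (mul_le_of_le_one_right hpow0 hτ1.le) hC1.le
    rw [h₁]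
    refine (norm_sub_le _ _).trans ?_
    linarith
  have hdiff : ‖τ ^ (2 * n + 1) • (C y - C x)‖ ≤ (B * M + 1) * |τ| ^ (2 * n + 2) := by
    rw [norm_smul, hnorm, hpow]
    calc _ ≤ |τ| ^ (2 * n + 1) * ((B * M + 1) * |τ|) := by gcongr
      _ = _ := by ring
  have hflow' : ‖φ τ x - y - (x - b)‖ ≤ L * (C1 + |Bc|) * |τ| ^ (2 * n + 2) := by
    rw [hpow]
    calc _ ≤ L * ‖x - b‖ * |τ| := hflow
      _ ≤ L * ((C1 + |Bc|) * |τ| ^ (2 * n + 1)) * |τ| := by gcongr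
      _ = _ := by ring
  have hfinal : y - S τ x = τ ^ (2 * n + 1) • (C y - C x) - (φ τ x - y - (x - b))
      - (x - b - (-τ ^ (2 * n + 1)) • C y) - (S τ x - φ τ x - τ ^ (2 * n + 1) • C x) := by
    rw [neg_smul, smul_sub]; abel
  rw [hfinal]
  have t₁ := norm_sub_le (τ ^ (2 * n + 1) • (C y - C x) - (φ τ x - y - (x - b))
      - (x - b - (-τ ^ (2 * n + 1)) • C y)) (S τ x - φ τ x - τ ^ (2 * n + 1) • C x)
  have t₂ := norm_sub_le (τ ^ (2 * n + 1) • (C y - C x) - (φ τ x - y - (x - b)))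
      (x - b - (-τ ^ (2 * n + 1)) • C y)
  have t₃ := norm_sub_le (τ ^ (2 * n + 1) • (C y - C x)) (φ τ x - y - (x - b))
  linarith
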